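/- Let n ≥ 1, let S = ℂ[x_1,…,x_n], and let f ∈ S be nonzero and squarefree. Let θ_1,…,θ_n ∈ D(f). If the determinant of the n×n matrix over S whose (i,j) entry is the i-th coordinate of θ_j equals c·f for some nonzero constant c ∈ ℂ, then (θ_1,…,θ_n) is a basis of the S-module D(f). (This is the case Cl(X) = 0, i.e. X = 𝔸^n, of the paper's toric Saito criterion, Theorem 4.2(i).) -/

import Mathlib

open MvPolynomial

/-- The extended logarithmic derivation module `D(f)`:
all `μ ∈ S^r` with `f ∣ Σ_i μ_i · ∂f/∂x_i`. -/
noncomputable def Dlog {r : ℕ} (f : MvPolynomial (Fin r) ℂ) :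
    Submodule (MvPolynomial (Fin r) ℂ) (Fin r → MvPolynomial (Fin r) ℂ) where
  carrier := {μ | f ∣ ∑ i, μ i * pderiv i f}
  add_mem' {a b} ha hb := by
    simpa [add_mul, Finset.sum_add_distrib] using dvd_add ha hb
  zero_mem' := by simp
  smul_mem' c μ hμ := by
    simpa [smul_eq_mul, mul_assoc, Finset.mul_sum] using hμ.mul_left c

namespace MvPolynomial

variable {σ R : Type*}

theorem totalDegree_pderiv_le [CommSemiring R] (i : σ) (p : MvPolynomial σ R) :
    (pderiv i p).totalDegree ≤ p.totalDegree - 1 := by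
  refine Finset.sup_le fun m hm => ?_
  rw [mem_support_iff, coeff_pderiv] at hm
  have h := le_totalDegree (mem_support_iff.mpr (left_ne_zero_of_mul hm))
  rw [Finsupp.sum_add_index' (fun _ => rfl) (fun _ _ _ => rfl),
    Finsupp.sum_single_index rfl] at h
  omega

theorem eq_C_of_pderiv_eq_zero [CommRing R] [IsDomain R] [CharZero R] {p : MvPolynomial σ R}
    (h : ∀ i, pderiv i p = 0) : p = C (coeff 0 p) := by
  classical
  ext m
  rw [coeff_C]
  split_ifs with hm
  · rw [hm]
  obtain ⟨i, hi⟩ := Finsupp.ne_iff.mp (Ne.symm hm)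
  have hcoeff := coeff_pderiv (i := i) p (m - Finsupp.single i 1)
  rw [h i, coeff_zero, Finsupp.sub_add_single_one_cancel hi] at hcoeff
  exact (mul_eq_zero.mp hcoeff.symm).resolve_right (Nat.cast_add_one_ne_zero _)

theorem pderiv_eq_zero_of_dvd [CommRing R] [IsDomain R] {i : σ} {p : MvPolynomial σ R}
    (h : p ∣ pderiv i p) : pderiv i p = 0 := by
  by_contra hne
  have hle := totalDegree_le_of_dvd_of_isDomain h hne
  have hdeg : p.totalDegree = 0 := by
    have := totalDegree_pderiv_le i p
    omega
  rw [totalDegree_eq_zero_iff_eq_C.mp hdeg, pderiv_C] at hne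
  exact hne rfl

theorem exists_not_dvd_pderiv_of_prime {K : Type*} [Field K] [CharZero K]
    {p : MvPolynomial σ K} (hp : Prime p) : ∃ i, ¬ p ∣ pderiv i p := by
  by_contra! h
  have hC := eq_C_of_pderiv_eq_zero fun i => pderiv_eq_zero_of_dvd (h i)
  have hne : coeff 0 p ≠ 0 := fun h0 => hp.ne_zero (by rw [hC, h0, C_0])
  exact hp.not_isUnit (hC ▸ (isUnit_iff_ne_zero.mpr hne).map C)

end MvPolynomial

theorem Squarefree.dvd_of_forall_prime_dvd {M : Type*} [CommMonoidWithZero M]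
    [UniqueFactorizationMonoid M] {a d : M} (hsq : Squarefree a) (ha : a ≠ 0)
    (h : ∀ p, Prime p → p ∣ a → p ∣ d) : a ∣ d := by
  induction a using UniqueFactorizationMonoid.induction_on_prime with
  | h₁ => exact absurd rfl ha
  | h₂ u hu => exact hu.dvd
  | h₃ a p ha' hp ih =>
    obtain ⟨e, rfl⟩ := ih (hsq.of_mul_right) ha' fun q hq hqa => h q hq (hqa.mul_left p)
    rw [mul_comm p a]
    refine mul_dvd_mul_left a ((hp.dvd_or_dvd (h p hp (dvd_mul_right p a))).resolve_left ?_)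
    exact fun hpa => hp.not_isUnit (hsq p (mul_dvd_mul_left p hpa))

open Matrix in
theorem Matrix.dvd_mul_det_of_dvd_vecMul {m A : Type*} [Fintype m] [DecidableEq m] [CommRing A]
    (N : Matrix m m A) (v : m → A) {f : A} (h : ∀ j, f ∣ (v ᵥ* N) j) (i : m) :
    f ∣ v i * N.det := by
  have hv : (v ᵥ* N) ᵥ* N.adjugate = N.det • v := by
    rw [vecMul_vecMul, mul_adjugate, vecMul_smul, vecMul_one]
  have hi := congrFun hv i
  rw [Pi.smul_apply, smul_eq_mul, mul_comm] at hi
  rw [← hi]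
  exact Finset.dvd_sum fun j _ => (h j).mul_right _

theorem dvd_det_of_mem_Dlog {n : ℕ} {f : MvPolynomial (Fin n) ℂ} (hf0 : f ≠ 0)
    (hsq : Squarefree f) (N : Matrix (Fin n) (Fin n) (MvPolynomial (Fin n) ℂ))
    (hN : ∀ j, N.col j ∈ Dlog f) : f ∣ N.det := by
  refine hsq.dvd_of_forall_prime_dvd hf0 ?_
  rintro p hp ⟨g, rfl⟩
  obtain ⟨i, hi⟩ := exists_not_dvd_pderiv_of_prime hp
  have hpg : ¬ p ∣ g := fun h => hp.not_isUnit (hsq p (mul_dvd_mul_left p h))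
  have hdvd : p * g ∣ pderiv i (p * g) * N.det :=
    N.dvd_mul_det_of_dvd_vecMul (fun i => pderiv i (p * g)) (fun j => by
      have hj : p * g ∣ ∑ i, N i j * pderiv i (p * g) := hN j
      simpa only [Matrix.vecMul, dotProduct, mul_comm (N _ j)] using hj) i
  refine (hp.dvd_or_dvd ((dvd_mul_right p g).trans hdvd)).resolve_left fun h => ?_
  rw [pderiv_mul, dvd_add_left (dvd_mul_right p _)] at h
  exact (hp.dvd_or_dvd h).elim hi hpg


/-- Saito's criterion ("if" direction) over `S = ℂ[x_1,…,x_n]`, i.e. the case `Cl(X) = 0`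
of the toric Saito criterion (Theorem 4.2(i)): if `θ_1,…,θ_n ∈ D(f)` and the determinant
of their coefficient matrix is a nonzero constant multiple of `f`, then `(θ_1,…,θ_n)`
is a basis of the `S`-module `D(f)`. -/
theorem saito_criterion_if_affine (n : ℕ) (hn : 1 ≤ n)
    (f : MvPolynomial (Fin n) ℂ) (hf0 : f ≠ 0) (hsq : Squarefree f)
    (θ : Fin n → Fin n → MvPolynomial (Fin n) ℂ)
    (hθ : ∀ j, θ j ∈ Dlog f)
    (c : ℂ) (hc : c ≠ 0)
    (hdet : (Matrix.of fun i j => θ j i).det = C c * f) :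
    LinearIndependent (MvPolynomial (Fin n) ℂ) θ ∧
      Submodule.span (MvPolynomial (Fin n) ℂ) (Set.range θ) = Dlog f := by
  have hCc : (C c : MvPolynomial (Fin n) ℂ) ≠ 0 := C_ne_zero.mpr hc
  have hdet0 : (Matrix.of fun i j => θ j i).det ≠ 0 := hdet ▸ mul_ne_zero hCc hf0
  refine ⟨Matrix.linearIndependent_cols_of_det_ne_zero hdet0, le_antisymm ?_ fun μ hμ => ?_⟩
  · rw [Submodule.span_le]
    rintro _ ⟨j, rfl⟩
    exact hθ j
  set M : Matrix (Fin n) (Fin n) (MvPolynomial (Fin n) ℂ) := Matrix.of fun i j => θ j i with hM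
  have hcramer : ∀ j, f ∣ M.cramer μ j := fun j => by
    rw [Matrix.cramer_apply]
    refine dvd_det_of_mem_Dlog hf0 hsq _ fun k => ?_
    by_cases hk : k = j
    · subst hk
      have hcol : (M.updateCol k μ).col k = μ := by
        ext1 i
        simp [Matrix.col]
      rwa [hcol]
    · have hcol : (M.updateCol j μ).col k = θ k := by
        ext1 i
        simp [Matrix.col, hk, hM]
      rw [hcol]
      exact hθ k
  choose q hq using hcramer
  have hμq : μ = ∑ j, (C c⁻¹ * q j) • θ j := by
    ext1 i
    have hi := congrFun (M.mulVec_cramer μ) i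
    simp only [Matrix.mulVec, dotProduct, hM, Matrix.of_apply, Pi.smul_apply, smul_eq_mul] at hi
    rw [← hM, hdet] at hi
    refine mul_left_cancel₀ (mul_ne_zero hCc hf0) ?_
    rw [← hi, Finset.sum_apply, Finset.mul_sum]
    refine Finset.sum_congr rfl fun j _ => ?_
    have hcc : (C c * C c⁻¹ : MvPolynomial (Fin n) ℂ) = 1 := by
      rw [← C_mul, mul_inv_cancel₀ hc, C_1]
    rw [Pi.smul_apply, smul_eq_mul, hq j]
    linear_combination (-(f * q j * θ j i)) * hcc
  rw [hμq]
  exact Submodule.sum_mem _ fun j _ =>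
    Submodule.smul_mem _ _ (Submodule.subset_span ⟨j, rfl⟩)
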